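/- Let Γ={g₁,…,g_k} be a finite set of orientation-preserving circle homeomorphisms whose action is equicontinuous and such that some generator has dense forward orbit. If for some gᵢ,gⱼ∈Γ the homeomorphism gᵢ⁻¹∘gⱼ has a dense forward orbit {(gᵢ⁻¹∘gⱼ)ⁿ(x):n≥1} in S¹ for some x, then for every probability vector p=(p₁,…,p_k) with all pᵢ>0 the Iterated Function System (Γ,p) is asymptotically stable: the Markov operator P has a unique invariant Borel probability measure μ* and Pⁿμ converges weakly to μ* for every Borel probability measure μ. -/

import Mathlib

open MeasureTheory Filter Topology

noncomputable section

/-- The circle `ℝ/ℤ` with normalized arc length (Haar probability measure as `volume`). -/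
abbrev S1 : Type := UnitAddCircle

/-- `h` is an orientation-preserving circle homeomorphism: it admits a strictly increasing
continuous lift `G : ℝ → ℝ` with `G (t+1) = G t + 1`. -/
def IsOPH (h : S1 ≃ₜ S1) : Prop :=
  ∃ G : ℝ → ℝ, StrictMono G ∧ Continuous G ∧ (∀ t, G (t + 1) = G t + 1) ∧
    ∀ t : ℝ, h ((t : ℝ) : S1) = ((G t : ℝ) : S1)

/-- For a word `w = [i₁, …, i_n]`, `applyWord g w = g_{i_n} ∘ ⋯ ∘ g_{i_1}`. -/
def applyWord {k : ℕ} (g : Fin k → S1 ≃ₜ S1) (w : List (Fin k)) (x : S1) : S1 :=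
  w.foldl (fun y i => g i y) x

/-- `Γ` is admissible: some generator has a dense forward orbit `{gᵢⁿ x : n ≥ 1}`. -/
def Admissible {k : ℕ} (g : Fin k → S1 ≃ₜ S1) : Prop :=
  ∃ i : Fin k, ∃ x : S1, Dense (Set.range fun n : ℕ => (⇑(g i))^[n + 1] x)

/-- The action of `Γ` is contractive: every `x` has an open arc neighbourhood whose image
under suitable words has Haar measure tending to `0`. -/
def Contractive {k : ℕ} (g : Fin k → S1 ≃ₜ S1) : Prop :=
  ∀ x : S1, ∃ a b : ℝ, a < b ∧ b - a < 1 ∧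
    x ∈ (fun t : ℝ => (t : S1)) '' Set.Ioo a b ∧
    ∃ w : ℕ → List (Fin k),
      Tendsto (fun m => volume (applyWord g (w m) '' ((fun t : ℝ => (t : S1)) '' Set.Ioo a b)))
        atTop (𝓝 0)

/-- The Markov operator `P μ = ∑ᵢ pᵢ • (gᵢ)_* μ` of the IFS `(Γ, p)`. -/
def markovP {k : ℕ} (p : Fin k → ℝ) (g : Fin k → S1 ≃ₜ S1) (μ : Measure S1) : Measure S1 :=
  ∑ i : Fin k, ENNReal.ofReal (p i) • Measure.map (g i) μ

/-- The dual operator `P* f x = ∑ᵢ pᵢ f (gᵢ x)`. -/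
def dualP {k : ℕ} (p : Fin k → ℝ) (g : Fin k → S1 ≃ₜ S1) (f : S1 → ℝ) (x : S1) : ℝ :=
  ∑ i : Fin k, p i * f (g i x)

/-- Asymptotic stability of the IFS `(Γ, p)`: there is a unique invariant Borel probability
measure `μ*`, and `Pⁿ μ → μ*` weakly for every Borel probability measure `μ`. -/
def AsympStable {k : ℕ} (p : Fin k → ℝ) (g : Fin k → S1 ≃ₜ S1) : Prop :=
  ∃ μs : Measure S1, IsProbabilityMeasure μs ∧ markovP p g μs = μs ∧
    (∀ ν : Measure S1, IsProbabilityMeasure ν → markovP p g ν = ν → ν = μs) ∧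
    ∀ μ : Measure S1, IsProbabilityMeasure μ → ∀ f : C(S1, ℝ),
      Tendsto (fun n => ∫ x, f x ∂((markovP p g)^[n] μ)) atTop (𝓝 (∫ x, f x ∂μs))

/-- Iterates of a surjective map with equicontinuous iterates on a compact space return
uniformly close to the identity. -/
theorem exists_iterate_uniformly_close_id {X : Type*} [PseudoMetricSpace X] [CompactSpace X]
    {T : X → X} (hT : Function.Surjective T) (hequi : UniformEquicontinuous fun n : ℕ => T^[n])
    {ε : ℝ} (hε : 0 < ε) : ∃ q : ℕ, ∀ y, dist (T^[q + 1] y) y < ε := by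
  obtain ⟨δ, hδ, hTδ⟩ := Metric.uniformEquicontinuous_iff.1 hequi (ε / 4) (by positivity)
  obtain ⟨t, -, htfin, ht⟩ := finite_cover_balls_of_compact (isCompact_univ (X := X))
    (lt_min hδ (by positivity : 0 < ε / 4))
  have hnet : ∀ x : X, ∃ s : t, dist x s < min δ (ε / 4) := fun x => by
    obtain ⟨s, hs, hxs⟩ := Set.mem_iUnion₂.1 (ht (Set.mem_univ x))
    exact ⟨⟨s, hs⟩, hxs⟩
  choose F hF using hnet
  have := htfin.to_subtype
  obtain ⟨n, m, hnm, hF_eq⟩ := Finite.exists_ne_map_eq_of_infinite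
    (fun (n : ℕ) (s : t) => F (T^[n] (s : X)))
  wlog hlt : n < m generalizing n m
  · exact this m n hnm.symm hF_eq.symm (lt_of_le_of_ne (not_lt.1 hlt) hnm.symm)
  obtain ⟨q, rfl⟩ := Nat.exists_eq_add_of_lt hlt
  refine ⟨q, fun y => ?_⟩
  obtain ⟨x, rfl⟩ := hT.iterate n y
  rw [← Function.iterate_add_apply, show q + 1 + n = n + q + 1 by ring]
  set s : X := (F x : X)
  have hxs : dist x s < δ := (hF x).trans_le (min_le_left _ _)
  have hsx : dist s x < δ := by rwa [dist_comm]
  have h1 := hTδ _ _ hxs (n + q + 1)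
  have h2 := hTδ _ _ hsx n
  have h3 := (hF (T^[n + q + 1] s)).trans_le (min_le_right _ _)
  have h4 := (hF (T^[n] s)).trans_le (min_le_right _ _)
  rw [show F (T^[n] s) = F (T^[n + q + 1] s) from congrFun hF_eq (F x), dist_comm] at h4
  have h5 := dist_triangle4 (T^[n + q + 1] x) (T^[n + q + 1] s) (T^[n] s) (T^[n] x)
  have h6 := dist_triangle (T^[n + q + 1] s) (F (T^[n + q + 1] s)) (T^[n] s)
  linarith

section Words

variable {k : ℕ} {g : Fin k → S1 ≃ₜ S1}

theorem applyWord_append (v w : List (Fin k)) (x : S1) :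
    applyWord g (v ++ w) x = applyWord g w (applyWord g v x) :=
  List.foldl_append

theorem applyWord_replicate (i : Fin k) (n : ℕ) (x : S1) :
    applyWord g (List.replicate n i) x = (⇑(g i))^[n] x := by
  induction n generalizing x with
  | zero => rfl
  | succ n ih => exact ih (g i x)

/-- Powers of a word close to `h` are close to the powers of `h`. -/
theorem exists_applyWord_pow_close
    (hequi : UniformEquicontinuous fun w : List (Fin k) => applyWord g w) (h : S1 → S1)
    (a : ℕ) {ε : ℝ} (hε : 0 < ε) :
    ∃ η > 0, ∀ u : List (Fin k), (∀ y, dist (applyWord g u y) (h y) < η) →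
      ∀ b ≤ a, ∀ x, dist (applyWord g (List.replicate b u).flatten x) (h^[b] x) < ε := by
  induction a generalizing ε with
  | zero =>
    refine ⟨1, one_pos, fun u _ b hb x => ?_⟩
    obtain rfl := Nat.le_zero.1 hb
    simpa [applyWord] using hε
  | succ a ih =>
    obtain ⟨η, hη, H⟩ := ih (half_pos hε)
    obtain ⟨δ, hδ, hequiδ⟩ := Metric.uniformEquicontinuous_iff.1 hequi _ (half_pos hε)
    refine ⟨min η δ, lt_min hη hδ, fun u hu b hb x => ?_⟩
    cases b with
    | zero => simpa [applyWord] using hε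
    | succ b =>
      rw [List.replicate_succ, List.flatten_cons, applyWord_append, Function.iterate_succ_apply]
      have h1 := hequiδ _ _ ((hu x).trans_le (min_le_right _ _)) (List.replicate b u).flatten
      have h2 := H u (fun y => (hu y).trans_le (min_le_left _ _)) b (by omega) (h x)
      have h3 := dist_triangle (applyWord g (List.replicate b u).flatten (applyWord g u x))
        (applyWord g (List.replicate b u).flatten (h x)) (h^[b] (h x))
      linarith

/-- Boundedly many powers of `gᵢ⁻¹ ∘ gⱼ` are approximated by words of a common length. -/
theorem exists_length_applyWord_close_iterate
    (hequi : UniformEquicontinuous fun w : List (Fin k) => applyWord g w) (i j : Fin k)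
    (a : ℕ) {ε : ℝ} (hε : 0 < ε) :
    ∃ n : ℕ, ∀ b ≤ a, ∃ w : List (Fin k), w.length = n ∧
      ∀ x, dist (applyWord g w x) ((fun y : S1 => (g i).symm (g j y))^[b] x) < ε := by
  set h : S1 → S1 := fun y => (g i).symm (g j y)
  obtain ⟨η, hη, H⟩ := exists_applyWord_pow_close hequi h a (half_pos hε)
  obtain ⟨η', hη', H'⟩ := exists_applyWord_pow_close hequi id a (half_pos hε)
  have hiter : UniformEquicontinuous fun n : ℕ => (⇑(g i))^[n] := by
    convert hequi.comp (fun n : ℕ => List.replicate n i) using 2 with n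
    exact funext fun x => (applyWord_replicate i n x).symm
  obtain ⟨q, hq⟩ := exists_iterate_uniformly_close_id (g i).surjective hiter (lt_min hη hη')
  have hu : ∀ y, dist (applyWord g (j :: List.replicate q i) y) (h y) < η := fun y => by
    have : applyWord g (j :: List.replicate q i) y = (⇑(g i))^[q + 1] (h y) := by
      change applyWord g (List.replicate q i) (g j y) = _
      simp [applyWord_replicate, h]
    rw [this]
    exact (hq _).trans_le (min_le_left _ _)
  have hu' : ∀ y, dist (applyWord g (List.replicate (q + 1) i) y) (id y) < η' := fun y => by
    rw [applyWord_replicate]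
    exact (hq _).trans_le (min_le_right _ _)
  refine ⟨a * (q + 1), fun b hb => ⟨(List.replicate b (j :: List.replicate q i)).flatten ++
    (List.replicate (a - b) (List.replicate (q + 1) i)).flatten, ?_, fun x => ?_⟩⟩
  · obtain ⟨c, rfl⟩ := Nat.exists_eq_add_of_le hb
    simp [add_mul]
  · rw [applyWord_append]
    have h1 := H _ hu b hb x
    have h2 := H' _ hu' (a - b) (Nat.sub_le _ _)
      (applyWord g (List.replicate b (j :: List.replicate q i)).flatten x)
    rw [Function.iterate_id, id] at h2
    have h3 := dist_triangle
      (applyWord g (List.replicate (a - b) (List.replicate (q + 1) i)).flatten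
        (applyWord g (List.replicate b (j :: List.replicate q i)).flatten x))
      (applyWord g (List.replicate b (j :: List.replicate q i)).flatten x) (h^[b] x)
    linarith

/-- If `gᵢ⁻¹ ∘ gⱼ` has a dense forward orbit, then all its forward orbits are dense. -/
theorem exists_iterate_dist_lt
    (hequi : UniformEquicontinuous fun w : List (Fin k) => applyWord g w) (i j : Fin k) {x₀ : S1}
    (hdense : Dense (Set.range fun n : ℕ => (fun y : S1 => (g i).symm (g j y))^[n + 1] x₀))
    (x y : S1) {ε : ℝ} (hε : 0 < ε) :
    ∃ b : ℕ, dist ((fun y : S1 => (g i).symm (g j y))^[b] x) y < ε := by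
  set h : S1 → S1 := fun y => (g i).symm (g j y)
  have hcont : Continuous h := (g i).symm.continuous.comp (g j).continuous
  have hsurj : Function.Surjective h := (g i).symm.surjective.comp (g j).surjective
  obtain ⟨δ, hδ, hequiδ⟩ := Metric.uniformEquicontinuous_iff.1 hequi (ε / 4) (by positivity)
  obtain ⟨_, ⟨s, rfl⟩, hs⟩ := hdense.exists_dist_lt x hδ
  have himage := (hsurj.iterate (s + 1)).denseRange.dense_image (hcont.iterate (s + 1)) hdense
  obtain ⟨_, ⟨_, ⟨b, rfl⟩, rfl⟩, hb⟩ :=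
    himage.exists_dist_lt y (by positivity : 0 < ε / 4)
  refine ⟨b + 1, ?_⟩
  obtain ⟨n, hn⟩ := exists_length_applyWord_close_iterate hequi i j (b + 1)
    (by positivity : 0 < ε / 4)
  obtain ⟨w, -, hw⟩ := hn (b + 1) le_rfl
  have hcomm : h^[s + 1] (h^[b + 1] x₀) = h^[b + 1] (h^[s + 1] x₀) := by
    rw [← Function.iterate_add_apply, ← Function.iterate_add_apply, add_comm]
  rw [hcomm, dist_comm] at hb
  have h1 := hw x
  have h2 := hw (h^[s + 1] x₀)
  have h3 := hequiδ _ _ hs w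
  rw [dist_comm] at h1
  have h4 := dist_triangle4 (h^[b + 1] x) (applyWord g w x) (applyWord g w (h^[s + 1] x₀))
    (h^[b + 1] (h^[s + 1] x₀))
  have h5 := dist_triangle (h^[b + 1] x) (h^[b + 1] (h^[s + 1] x₀)) y
  linarith

/-- Words of a suitable fixed length move every point close to every other point. -/
theorem exists_length_forall_exists_applyWord_dist_lt
    (hequi : UniformEquicontinuous fun w : List (Fin k) => applyWord g w) (i j : Fin k) {x₀ : S1}
    (hdense : Dense (Set.range fun n : ℕ => (fun y : S1 => (g i).symm (g j y))^[n + 1] x₀))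
    {ε : ℝ} (hε : 0 < ε) :
    ∃ n : ℕ, ∀ x y : S1, ∃ w : List (Fin k), w.length = n ∧ dist (applyWord g w x) y < ε := by
  obtain ⟨δ, hδ, hequiδ⟩ := Metric.uniformEquicontinuous_iff.1 hequi (ε / 4) (by positivity)
  obtain ⟨t, -, htfin, ht⟩ := finite_cover_balls_of_compact (isCompact_univ (X := S1))
    (lt_min hδ (by positivity : 0 < ε / 4))
  choose b hb using fun x y : S1 =>
    exists_iterate_dist_lt hequi i j hdense x y (by positivity : 0 < ε / 4)
  obtain ⟨a, ha⟩ := ((htfin.prod htfin).image fun z : S1 × S1 => b z.1 z.2).bddAbove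
  obtain ⟨n, hn⟩ := exists_length_applyWord_close_iterate hequi i j a (by positivity : 0 < ε / 4)
  refine ⟨n, fun x y => ?_⟩
  obtain ⟨s, hs, hxs⟩ := Set.mem_iUnion₂.1 (ht (Set.mem_univ x))
  obtain ⟨r, hr, hyr⟩ := Set.mem_iUnion₂.1 (ht (Set.mem_univ y))
  obtain ⟨w, hwn, hw⟩ := hn (b s r) (ha ⟨(s, r), ⟨hs, hr⟩, rfl⟩)
  refine ⟨w, hwn, ?_⟩
  have h1 := hequiδ _ _ (lt_of_lt_of_le (Metric.mem_ball.1 hxs) (min_le_left _ _)) w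
  have h2 := hw s
  have h3 := hb s r
  have h4 := lt_of_lt_of_le (Metric.mem_ball.1 hyr) (min_le_right _ _)
  rw [dist_comm] at h4
  have h5 := dist_triangle4 (applyWord g w x) (applyWord g w s)
    ((fun y : S1 => (g i).symm (g j y))^[b s r] s) r
  have h6 := dist_triangle (applyWord g w x) r y
  linarith

end Words

section Dual

variable {k : ℕ} {g : Fin k → S1 ≃ₜ S1} {p : Fin k → ℝ}

theorem continuous_dualP {f : S1 → ℝ} (hf : Continuous f) : Continuous (dualP p g f) := by
  unfold dualP
  fun_prop

theorem continuous_dualP_iterate {f : S1 → ℝ} (hf : Continuous f) (n : ℕ) :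
    Continuous ((dualP p g)^[n] f) :=
  Function.Iterate.rec (fun f : S1 → ℝ => Continuous f) hf (fun _ => continuous_dualP) n

theorem dualP_mem_Icc (hp : ∀ i, 0 ≤ p i) (hsum : ∑ i, p i = 1) {f : S1 → ℝ} {m M : ℝ}
    (hf : ∀ x, f x ∈ Set.Icc m M) (x : S1) : dualP p g f x ∈ Set.Icc m M :=
  (convex_Icc m M).sum_mem (fun i _ => hp i) hsum fun i _ => hf (g i x)

theorem dualP_iterate_mem_Icc (hp : ∀ i, 0 ≤ p i) (hsum : ∑ i, p i = 1) {f : S1 → ℝ} {m M : ℝ}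
    (hf : ∀ x, f x ∈ Set.Icc m M) (n : ℕ) (x : S1) : (dualP p g)^[n] f x ∈ Set.Icc m M :=
  Function.Iterate.rec (fun f : S1 → ℝ => ∀ x, f x ∈ Set.Icc m M) hf
    (fun _ => dualP_mem_Icc hp hsum) n x

/-- A value of `f` below `M` along a word lowers the iterate of the dual operator. -/
theorem dualP_iterate_le (hsum : ∑ i, p i = 1) {c : ℝ} (hc : 0 ≤ c) (hcp : ∀ i, c ≤ p i)
    {f : S1 → ℝ} {m M r : ℝ} (hf : ∀ x, f x ∈ Set.Icc m M) (hr : r ≤ M) (w : List (Fin k)) (x : S1)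
    (hw : f (applyWord g w x) ≤ r) :
    (dualP p g)^[w.length] f x ≤ M - c ^ w.length * (M - r) := by
  have hp : ∀ i, 0 ≤ p i := fun i => hc.trans (hcp i)
  induction w generalizing x with
  | nil => simpa [applyWord] using hw
  | cons i w ih =>
    rw [List.length_cons, Function.iterate_succ_apply']
    set φ := (dualP p g)^[w.length] f
    have h1 : φ (g i x) ≤ M - c ^ w.length * (M - r) := ih (g i x) hw
    have hφ : ∀ y, φ y ≤ M := fun y => (dualP_iterate_mem_Icc hp hsum hf _ y).2
    have h2 : p i * (M - φ (g i x)) ≤ ∑ l, p l * (M - φ (g l x)) :=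
      Finset.single_le_sum (f := fun l => p l * (M - φ (g l x)))
        (fun l _ => mul_nonneg (hp l) (sub_nonneg.2 (hφ _))) (Finset.mem_univ i)
    have h3 : ∑ l, p l * (M - φ (g l x)) = M - dualP p g φ x := by
      simp only [mul_sub, Finset.sum_sub_distrib, ← Finset.sum_mul, hsum, one_mul, dualP]
    have h4 : c * (c ^ w.length * (M - r)) ≤ p i * (M - φ (g i x)) :=
      mul_le_mul (hcp i) (by linarith) (mul_nonneg (by positivity) (by linarith)) (hp i)
    rw [pow_succ']
    linarith

/-- The iterates of the dual operator inherit a modulus of continuity along all words. -/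
theorem abs_dualP_iterate_sub_le (hp : ∀ i, 0 ≤ p i) (hsum : ∑ i, p i = 1) {f : S1 → ℝ} {δ ε : ℝ}
    (hf : ∀ x y, dist x y < δ → ∀ w, |f (applyWord g w x) - f (applyWord g w y)| ≤ ε) (n : ℕ)
    {x y : S1} (hxy : dist x y < δ) :
    |(dualP p g)^[n] f x - (dualP p g)^[n] f y| ≤ ε := by
  refine Function.Iterate.rec (fun f : S1 → ℝ => ∀ x y, dist x y < δ →
    ∀ w, |f (applyWord g w x) - f (applyWord g w y)| ≤ ε) hf (fun φ hφ x y hxy w => ?_) n x y hxy []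
  have happend : ∀ l z, g l (applyWord g w z) = applyWord g (w ++ [l]) z := fun l z => by
    rw [applyWord_append]; rfl
  calc |dualP p g φ (applyWord g w x) - dualP p g φ (applyWord g w y)|
      = |∑ l, p l * (φ (applyWord g (w ++ [l]) x) - φ (applyWord g (w ++ [l]) y))| := by
        simp only [dualP, mul_sub, Finset.sum_sub_distrib, happend]
    _ ≤ ∑ l, |p l * (φ (applyWord g (w ++ [l]) x) - φ (applyWord g (w ++ [l]) y))| :=
        Finset.abs_sum_le_sum_abs _ _
    _ ≤ ∑ l, p l * ε := Finset.sum_le_sum fun l _ => by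
        rw [abs_mul, abs_of_nonneg (hp l)]
        exact mul_le_mul_of_nonneg_left (hφ x y hxy _) (hp l)
    _ = ε := by rw [← Finset.sum_mul, hsum, one_mul]

/-- Some iterate of the dual operator is nearly constant. -/
theorem exists_dualP_iterate_mem_Icc
    (hequi : UniformEquicontinuous fun w : List (Fin k) => applyWord g w)
    (hreach : ∀ ε > 0, ∃ n : ℕ, ∀ x y : S1, ∃ w : List (Fin k),
      w.length = n ∧ dist (applyWord g w x) y < ε)
    (hp : ∀ i, 0 < p i) (hsum : ∑ i, p i = 1) {f : S1 → ℝ} (hf : Continuous f) {ε : ℝ}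
    (hε : 0 < ε) :
    ∃ (n : ℕ) (m M : ℝ), M - m < ε ∧ ∀ x, (dualP p g)^[n] f x ∈ Set.Icc m M := by
  have hp' : ∀ i, 0 ≤ p i := fun i => (hp i).le
  have : Nonempty (Fin k) := by
    by_contra hk
    rw [not_nonempty_iff] at hk
    simp at hsum
  obtain ⟨i₀, hi₀⟩ := Finite.exists_min p
  obtain ⟨δ', hδ', hfδ'⟩ := Metric.uniformContinuous_iff.1
    (CompactSpace.uniformContinuous_of_continuous hf) (ε / 2) (by positivity)
  obtain ⟨δ, hδ, hequiδ⟩ := Metric.uniformEquicontinuous_iff.1 hequi δ' hδ'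
  have hmod : ∀ x y, dist x y < δ → ∀ w,
      |f (applyWord g w x) - f (applyWord g w y)| ≤ ε / 2 := fun x y hxy w => by
    have := hfδ' (hequiδ x y hxy w)
    rw [Real.dist_eq] at this
    exact this.le
  obtain ⟨n, hn⟩ := hreach δ hδ
  set D : ℝ := p i₀ ^ n
  have hD : 0 < D := pow_pos (hp i₀) n
  have hD1 : D ≤ 1 := pow_le_one₀ (hp' i₀)
    (hsum ▸ Finset.single_le_sum (fun i _ => hp' i) (Finset.mem_univ i₀))
  obtain ⟨K, hK⟩ := (isCompact_range hf).isBounded.subset_closedBall 0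
  have hfK : ∀ x, f x ∈ Set.Icc (-K) K := fun x => by
    have := hK (Set.mem_range_self x)
    rwa [Metric.mem_closedBall, dist_zero_right, Real.norm_eq_abs, abs_le] at this
  have key : ∀ j : ℕ, ∃ m M : ℝ, M - m ≤ (1 - D) ^ j * (K - -K) + ε / 2 ∧
      ∀ x, (dualP p g)^[n * j] f x ∈ Set.Icc m M := by
    intro j
    induction j with
    | zero => exact ⟨-K, K, by simp; positivity, hfK⟩
    | succ j ih =>
      obtain ⟨m, M, hmM, hφ⟩ := ih
      have hiter : (dualP p g)^[n * (j + 1)] f = (dualP p g)^[n] ((dualP p g)^[n * j] f) := by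
        rw [← Function.iterate_add_apply, mul_add, mul_one, add_comm]
      rw [hiter]
      have hφmod := fun x y (hxy : dist x y < δ) =>
        abs_dualP_iterate_sub_le hp' hsum hmod (n * j) hxy
      have hφcont := continuous_dualP_iterate (p := p) (g := g) hf (n * j)
      set φ := (dualP p g)^[n * j] f
      obtain ⟨y, -, hy⟩ := isCompact_univ.exists_isMinOn Set.univ_nonempty hφcont.continuousOn
      have hymin : ∀ x, φ y ≤ φ x := fun x => hy (Set.mem_univ x)
      have hφy : ∀ x, φ x ∈ Set.Icc (φ y) M := fun x => ⟨hymin x, (hφ x).2⟩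
      have hrM : min M (φ y + ε / 2) ≤ M := min_le_left _ _
      refine ⟨φ y, M - D * (M - min M (φ y + ε / 2)), ?_, fun x =>
        ⟨(dualP_iterate_mem_Icc hp' hsum hφy n x).1, ?_⟩⟩
      · have hL : M - φ y ≤ (1 - D) ^ j * (K - -K) + ε / 2 := by linarith [(hφ y).1]
        have hK0 : 0 ≤ (1 - D) ^ (j + 1) * (K - -K) :=
          mul_nonneg (pow_nonneg (by linarith) _) (by linarith [(hfK 0).1, (hfK 0).2])
        rcases le_total M (φ y + ε / 2) with h | h
        · rw [min_eq_left h]; linarith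
        · rw [min_eq_right h, pow_succ']
          have := mul_le_mul_of_nonneg_left hL (by linarith : 0 ≤ 1 - D)
          linarith
      · obtain ⟨w, hwn, hw⟩ := hn x y
        have hval : φ (applyWord g w x) ≤ min M (φ y + ε / 2) :=
          le_min (hφ _).2 (by linarith [(abs_le.1 (hφmod _ _ hw)).2])
        have := dualP_iterate_le hsum (hp' i₀) hi₀ hφy hrM w x hval
        rwa [hwn] at this
  have hlim : Tendsto (fun j : ℕ => (1 - D) ^ j * (K - -K)) atTop (𝓝 0) := by
    simpa using (tendsto_pow_atTop_nhds_zero_of_lt_one (by linarith : 0 ≤ 1 - D)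
      (by linarith)).mul_const (K - -K)
  obtain ⟨j, hj⟩ := (hlim.eventually (gt_mem_nhds (half_pos hε))).exists
  obtain ⟨m, M, hmM, hφ⟩ := key j
  exact ⟨n * j, m, M, by linarith, hφ⟩

end Dual

section Markov

variable {k : ℕ} {g : Fin k → S1 ≃ₜ S1} {p : Fin k → ℝ}

theorem isProbabilityMeasure_markovP (hp : ∀ i, 0 ≤ p i) (hsum : ∑ i, p i = 1) (μ : Measure S1)
    [IsProbabilityMeasure μ] : IsProbabilityMeasure (markovP p g μ) := by
  refine ⟨?_⟩
  have hmap : ∀ i, Measure.map (g i) μ Set.univ = 1 := fun i => by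
    rw [Measure.map_apply (g i).continuous.measurable MeasurableSet.univ]
    simp
  simp only [markovP, Measure.coe_finsetSum, Finset.sum_apply, Measure.smul_apply, hmap,
    smul_eq_mul, mul_one]
  rw [← ENNReal.ofReal_sum_of_nonneg fun i _ => hp i, hsum, ENNReal.ofReal_one]

theorem isProbabilityMeasure_markovP_iterate (hp : ∀ i, 0 ≤ p i) (hsum : ∑ i, p i = 1)
    (μ : Measure S1) [hμ : IsProbabilityMeasure μ] (n : ℕ) :
    IsProbabilityMeasure ((markovP p g)^[n] μ) :=
  Function.Iterate.rec (fun μ : Measure S1 => IsProbabilityMeasure μ) hμ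
    (fun ν _ => isProbabilityMeasure_markovP hp hsum ν) n

theorem integral_markovP (hp : ∀ i, 0 ≤ p i) (μ : Measure S1) [IsProbabilityMeasure μ]
    {f : S1 → ℝ} (hf : Continuous f) :
    ∫ x, f x ∂(markovP p g μ) = ∫ x, dualP p g f x ∂μ := by
  have hint : ∀ (ν : Measure S1) [IsFiniteMeasure ν] {φ : S1 → ℝ}, Continuous φ →
      Integrable φ ν := fun ν _ φ hφ =>
    hφ.integrable_of_hasCompactSupport (HasCompactSupport.of_compactSpace φ)
  unfold markovP dualP
  rw [integral_finsetSum_measure fun i _ => (hint _ hf).smul_measure ENNReal.ofReal_ne_top,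
    integral_finsetSum _ fun i _ => (hint μ (φ := fun x => f (g i x))
      (hf.comp (g i).continuous)).const_mul (p i)]
  refine Finset.sum_congr rfl fun i _ => ?_
  rw [integral_smul_measure, ENNReal.toReal_ofReal (hp i),
    integral_map (g i).continuous.aemeasurable hf.aestronglyMeasurable, integral_const_mul,
    smul_eq_mul]

theorem integral_markovP_iterate (hp : ∀ i, 0 ≤ p i) (hsum : ∑ i, p i = 1) (μ : Measure S1)
    [IsProbabilityMeasure μ] {f : S1 → ℝ} (hf : Continuous f) (n : ℕ) :
    ∫ x, f x ∂((markovP p g)^[n] μ) = ∫ x, (dualP p g)^[n] f x ∂μ := by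
  induction n generalizing f with
  | zero => rfl
  | succ n ih =>
    have := isProbabilityMeasure_markovP_iterate (g := g) hp hsum μ n
    rw [Function.iterate_succ_apply', integral_markovP hp _ hf, ih (continuous_dualP hf),
      Function.iterate_succ_apply]

/-- If the iterates of the dual operator become nearly constant, the integrals of a continuous
function against all orbits of the Markov operator have a common limit. -/
theorem exists_tendsto_integral_markovP_iterate (hp : ∀ i, 0 ≤ p i) (hsum : ∑ i, p i = 1)
    {f : S1 → ℝ} (hf : Continuous f)
    (hosc : ∀ ε > 0, ∃ (n : ℕ) (m M : ℝ), M - m < ε ∧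
      ∀ x, (dualP p g)^[n] f x ∈ Set.Icc m M) :
    ∃ c : ℝ, ∀ μ : Measure S1, IsProbabilityMeasure μ →
      Tendsto (fun n => ∫ x, f x ∂((markovP p g)^[n] μ)) atTop (𝓝 c) := by
  have hclose : ∀ ε > 0, ∃ N : ℕ, ∀ μ ν : Measure S1, IsProbabilityMeasure μ →
      IsProbabilityMeasure ν → ∀ a ≥ N, ∀ b ≥ N,
      dist (∫ x, f x ∂((markovP p g)^[a] μ)) (∫ x, f x ∂((markovP p g)^[b] ν)) < ε := by
    intro ε hε
    obtain ⟨N, m, M, hmM, hφ⟩ := hosc ε hε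
    have hmem : ∀ μ : Measure S1, IsProbabilityMeasure μ → ∀ a ≥ N,
        ∫ x, f x ∂((markovP p g)^[a] μ) ∈ Set.Icc m M := by
      intro μ _ a ha
      rw [integral_markovP_iterate hp hsum μ hf a]
      obtain ⟨d, rfl⟩ := Nat.exists_eq_add_of_le ha
      rw [add_comm, Function.iterate_add_apply]
      exact (convex_Icc m M).integral_mem isClosed_Icc
        (Eventually.of_forall (dualP_iterate_mem_Icc hp hsum hφ d))
        ((continuous_dualP_iterate (continuous_dualP_iterate hf N) d).integrable_of_hasCompactSupport
          (HasCompactSupport.of_compactSpace _))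
    refine ⟨N, fun μ ν hμ hν a ha b hb => ?_⟩
    exact (Real.dist_le_of_mem_Icc (hmem μ hμ a ha) (hmem ν hν b hb)).trans_lt hmM
  obtain ⟨c, hc⟩ := cauchySeq_tendsto_of_complete
    (u := fun n => ∫ x, f x ∂((markovP p g)^[n] (Measure.dirac 0))) <| Metric.cauchySeq_iff.2
      fun ε hε => (hclose ε hε).imp fun N hN a ha b hb =>
        hN _ _ inferInstance inferInstance a ha b hb
  refine ⟨c, fun μ hμ => tendsto_of_tendsto_of_dist hc <| Metric.tendsto_atTop.2 fun ε hε =>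
    (hclose ε hε).imp fun N hN n hn => ?_⟩
  rw [Real.dist_0_eq_abs, abs_of_nonneg dist_nonneg]
  exact hN _ _ inferInstance hμ n hn n hn

theorem asympStable_of_tendsto_integral (hp : ∀ i, 0 ≤ p i) (hsum : ∑ i, p i = 1)
    (hlim : ∀ f : S1 → ℝ, Continuous f → ∃ c : ℝ, ∀ μ : Measure S1, IsProbabilityMeasure μ →
      Tendsto (fun n => ∫ x, f x ∂((markovP p g)^[n] μ)) atTop (𝓝 c)) :
    AsympStable p g := by
  choose ℓ hℓ using hlim
  let u : ℕ → ProbabilityMeasure S1 := fun n =>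
    ⟨(markovP p g)^[n] (Measure.dirac 0), isProbabilityMeasure_markovP_iterate hp hsum _ n⟩
  obtain ⟨μs, -, hμs⟩ := isCompact_univ.exists_mapClusterPt (f := atTop) (u := u)
    (by simp)
  have hμsℓ : ∀ (f : S1 → ℝ) (hf : Continuous f), ∫ x, f x ∂(μs : Measure S1) = ℓ f hf := by
    intro f hf
    obtain ⟨F, hF, hFμ⟩ := mapClusterPt_iff_ultrafilter.1 hμs
    exact tendsto_nhds_unique
      (ProbabilityMeasure.tendsto_iff_forall_integral_tendsto.1 hFμ
        (BoundedContinuousFunction.mkOfCompact ⟨f, hf⟩))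
      ((hℓ f hf _ inferInstance).mono_left hF)
  have hext : ∀ ν : Measure S1, IsProbabilityMeasure ν →
      (∀ (f : S1 → ℝ) (hf : Continuous f), ∫ x, f x ∂ν = ℓ f hf) → ν = μs := fun ν _ hν =>
    ext_of_forall_integral_eq_of_IsFiniteMeasure fun f => by
      rw [hν f f.continuous, hμsℓ f f.continuous]
  refine ⟨μs, inferInstance, ?_, fun ν hν hinv => hext ν hν fun f hf => ?_, fun μ hμ f => ?_⟩
  · refine hext _ (isProbabilityMeasure_markovP hp hsum _) fun f hf => ?_
    rw [integral_markovP hp _ hf, hμsℓ _ (continuous_dualP hf)]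
    refine tendsto_nhds_unique (hℓ _ (continuous_dualP hf) (Measure.dirac 0) inferInstance) ?_
    have h := (tendsto_add_atTop_iff_nat 1).2 (hℓ f hf (Measure.dirac 0) inferInstance)
    refine h.congr fun n => ?_
    have := isProbabilityMeasure_markovP_iterate (g := g) hp hsum (Measure.dirac 0) n
    rw [Function.iterate_succ_apply', integral_markovP hp _ hf]
  · refine tendsto_nhds_unique ?_ (hℓ f hf ν hν)
    simp only [Function.iterate_fixed hinv]
    exact tendsto_const_nhds
  · rw [hμsℓ f f.continuous]
    exact hℓ f f.continuous μ hμ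

end Markov

/-- If the action of `Γ` is equicontinuous, some generator has a dense
forward orbit, and for some `gᵢ, gⱼ ∈ Γ` the homeomorphism `gᵢ⁻¹ ∘ gⱼ` has a dense forward
orbit, then `(Γ, p)` is asymptotically stable for every strictly positive probability vector. -/
theorem equicontinuous_dense_quotient_orbit_asymptotically_stable {k : ℕ}
    (g : Fin k → S1 ≃ₜ S1) (hg : ∀ i, IsOPH (g i))
    (hequi : Equicontinuous (fun w : List (Fin k) => applyWord g w))
    (hadm : Admissible g)
    (hdense : ∃ i j : Fin k, ∃ x : S1,
      Dense (Set.range fun n : ℕ => (fun y : S1 => (g i).symm (g j y))^[n + 1] x))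
    (p : Fin k → ℝ) (hp : ∀ i, 0 < p i) (hsum : ∑ i, p i = 1) :
    AsympStable p g := by
  obtain ⟨i, j, x₀, hx₀⟩ := hdense
  have hp' : ∀ i, 0 ≤ p i := fun i => (hp i).le
  have hunif := CompactSpace.uniformEquicontinuous_of_equicontinuous hequi
  refine asympStable_of_tendsto_integral hp' hsum fun f hf =>
    exists_tendsto_integral_markovP_iterate hp' hsum hf fun ε hε =>
      exists_dualP_iterate_mem_Icc hunif (fun δ hδ => ?_) hp hsum hf hε
  exact exists_length_forall_exists_applyWord_dist_lt hunif i j hx₀ hδ
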